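/- For every integer N ≥ 3, every ℏ > 0, every λ = (λ_1,…,λ_N) ∈ ℝ^N and every x ∈ ℝ^N, the Givental integral satisfies the recursion Ψ^{(N)}_{λ_1,…,λ_N}(x) = ∫_{ℝ^{N−1}} Q^{(N)}_{λ_N}(x; y) · Ψ^{(N−1)}_{λ_1,…,λ_{N−1}}(y) dy, where the integrand on the right-hand side is absolutely integrable over y ∈ ℝ^{N−1} and where Q^{(N)}_{λ_N}(x; y) = exp{ (i λ_N/ℏ)( Σ_{i=1}^{N} x_i − Σ_{i=1}^{N−1} y_i ) − (1/ℏ) Σ_{i=1}^{N−1} ( e^{x_i − y_i} + e^{y_i − x_{i+1}} ) }. -/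

import Mathlib

open MeasureTheory

noncomputable section

/-- The index set of the Givental variables `T_{k,i}`, `1 ≤ i ≤ k ≤ N−1`: the pair
`(p₁, p₂) : Fin N × Fin N` encodes `(k, i) = (p₁+1, p₂+1)`. It has `N(N−1)/2` elements. -/
abbrev GIdx (N : ℕ) : Type :=
  {p : Fin N × Fin N // p.2.val ≤ p.1.val ∧ p.1.val + 1 ≤ N - 1}

/-- The value `T_{k,i}` (1-based indices) of a point `T : GIdx N → ℝ` of the Givental
integration domain, with the boundary convention `T_{N,i} := x_i`; the value is `0` for
out-of-range indices. -/
def gval (N : ℕ) (x : Fin N → ℝ) (T : GIdx N → ℝ) (k i : ℕ) : ℝ :=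
  if h : 1 ≤ i ∧ i ≤ k ∧ k ≤ N - 1 then
    T ⟨(⟨k - 1, by omega⟩, ⟨i - 1, by omega⟩),
       ⟨by show i - 1 ≤ k - 1; omega, by show k - 1 + 1 ≤ N - 1; omega⟩⟩
  else if h' : k = N ∧ 1 ≤ i ∧ i ≤ N then x ⟨i - 1, by omega⟩
  else 0

/-- The Givental potential
`𝓕_N(T; λ, x) = i Σ_{k=1}^{N} λ_k (Σ_{i=1}^{k} T_{k,i} − Σ_{i=1}^{k−1} T_{k−1,i})
 − Σ_{k=1}^{N−1} Σ_{i=1}^{k} (e^{T_{k+1,i} − T_{k,i}} + e^{T_{k,i} − T_{k+1,i+1}})`,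
with `T_{N,i} := x_i`. -/
def Fpot (N : ℕ) (lam x : Fin N → ℝ) (T : GIdx N → ℝ) : ℂ :=
  Complex.I * ∑ a : Fin N, (lam a : ℂ) *
      ((∑ i ∈ Finset.Icc 1 (a.val + 1), (gval N x T (a.val + 1) i : ℂ))
        - ∑ i ∈ Finset.Icc 1 a.val, (gval N x T a.val i : ℂ))
    - ∑ k ∈ Finset.Icc 1 (N - 1), ∑ i ∈ Finset.Icc 1 k,
        ((Real.exp (gval N x T (k + 1) i - gval N x T k i) : ℂ)
          + (Real.exp (gval N x T k i - gval N x T (k + 1) (i + 1)) : ℂ))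

/-- The Givental integrand `T ↦ exp( 𝓕_N(T; λ, x) / ℏ )`. -/
def givIntegrand (N : ℕ) (hbar : ℝ) (lam x : Fin N → ℝ) (T : GIdx N → ℝ) : ℂ :=
  Complex.exp (Fpot N lam x T / (hbar : ℂ))

/-- The Givental integral `Ψ^{(N)}_λ(x) = ∫ exp( 𝓕_N(T; λ, x) / ℏ ) dT` over
`ℝ^{N(N−1)/2}`. -/
def GivPsi (N : ℕ) (hbar : ℝ) (lam : Fin N → ℝ) (x : Fin N → ℝ) : ℂ :=
  ∫ T : GIdx N → ℝ, givIntegrand N hbar lam x T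

/-- The kernel
`Q^{(N)}_v(x; y) = exp( (i v/ℏ)(Σ_{i=1}^N x_i − Σ_{i=1}^{N−1} y_i)
  − (1/ℏ) Σ_{i=1}^{N−1} (e^{x_i − y_i} + e^{y_i − x_{i+1}}) )`. -/
def Qker (N : ℕ) (hbar : ℝ) (v : ℂ) (x : Fin N → ℝ) (y : Fin (N - 1) → ℝ) : ℂ :=
  Complex.exp
    (Complex.I * v / (hbar : ℂ) * ((∑ i : Fin N, (x i : ℂ)) - ∑ i : Fin (N - 1), (y i : ℂ))
      - (1 / (hbar : ℂ)) * ∑ i : Fin (N - 1),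
          ((Real.exp (x (Fin.castLE (Nat.sub_le N 1) i) - y i) : ℂ)
            + (Real.exp (y i - if h : i.val + 1 < N then x ⟨i.val + 1, h⟩ else 0) : ℂ)))

/-! ### Integrability of the Givental integrand -/

lemma integrable_exp_neg_mul_abs {c : ℝ} (hc : 0 < c) :
    Integrable (fun t : ℝ => Real.exp (-(c * |t|))) := by
  rw [← integrableOn_univ, ← Set.Iic_union_Ioi (a := (0 : ℝ))]
  refine IntegrableOn.union ?_ ?_
  · refine (integrableOn_exp_mul_Iic hc 0).congr_fun (fun t ht => ?_) measurableSet_Iic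
    rw [abs_of_nonpos ht]
    simp
  · refine (integrableOn_exp_mul_Ioi (neg_neg_of_pos hc) 0).congr_fun (fun t ht => ?_)
      measurableSet_Ioi
    rw [abs_of_pos ht]
    simp

lemma integrable_exp_neg_mul_sum_abs {ι : Type*} [Fintype ι] {c : ℝ} (hc : 0 < c) :
    Integrable (fun T : ι → ℝ => Real.exp (-(c * ∑ p, |T p|))) := by
  have h : Integrable (fun T : ι → ℝ => ∏ p, Real.exp (-(c * |T p|))) volume :=
    Integrable.fintype_prod fun _ => integrable_exp_neg_mul_abs hc
  simpa only [← Real.exp_sum, Finset.sum_neg_distrib, ← Finset.mul_sum] using h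

lemma continuous_gval (N : ℕ) (x : Fin N → ℝ) (k i : ℕ) :
    Continuous fun T : GIdx N → ℝ => gval N x T k i := by
  unfold gval
  split_ifs <;> fun_prop

lemma continuous_givIntegrand (N : ℕ) (hbar : ℝ) (lam x : Fin N → ℝ) :
    Continuous (givIntegrand N hbar lam x) := by
  have h := fun k i => continuous_gval N x k i
  unfold givIntegrand Fpot
  fun_prop

/-- The `k`-th row of the exponential interaction in the Givental potential. -/
def rowEnergy (N : ℕ) (x : Fin N → ℝ) (T : GIdx N → ℝ) (k : ℕ) : ℝ :=
  ∑ i ∈ Finset.Icc 1 k, (Real.exp (gval N x T (k + 1) i - gval N x T k i)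
    + Real.exp (gval N x T k i - gval N x T (k + 1) (i + 1)))

lemma rowEnergy_nonneg (N : ℕ) (x : Fin N → ℝ) (T : GIdx N → ℝ) (k : ℕ) :
    0 ≤ rowEnergy N x T k :=
  Finset.sum_nonneg fun _ _ => by positivity

lemma Fpot_re (N : ℕ) (lam x : Fin N → ℝ) (T : GIdx N → ℝ) :
    (Fpot N lam x T).re = -∑ k ∈ Finset.Icc 1 (N - 1), rowEnergy N x T k := by
  simp only [Fpot, rowEnergy, ← Complex.ofReal_sum, ← Complex.ofReal_sub, ← Complex.ofReal_mul,
    ← Complex.ofReal_add, Complex.sub_re, Complex.I_mul_re, Complex.ofReal_im, Complex.ofReal_re,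
    neg_zero, zero_sub]

lemma norm_givIntegrand (N : ℕ) (hbar : ℝ) (lam x : Fin N → ℝ) (T : GIdx N → ℝ) :
    ‖givIntegrand N hbar lam x T‖
      = Real.exp (-((∑ k ∈ Finset.Icc 1 (N - 1), rowEnergy N x T k) / hbar)) := by
  rw [givIntegrand, Complex.norm_exp, Complex.div_ofReal_re, Fpot_re, neg_div]

lemma abs_gval_le_add_rowEnergy (N : ℕ) (x : Fin N → ℝ) (T : GIdx N → ℝ) {k i : ℕ}
    (hi : 1 ≤ i) (hik : i ≤ k) {B : ℝ} (h₁ : |gval N x T (k + 1) i| ≤ B)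
    (h₂ : |gval N x T (k + 1) (i + 1)| ≤ B) :
    |gval N x T k i| ≤ B + rowEnergy N x T k := by
  have hle : Real.exp (gval N x T (k + 1) i - gval N x T k i)
      + Real.exp (gval N x T k i - gval N x T (k + 1) (i + 1)) ≤ rowEnergy N x T k :=
    Finset.single_le_sum
      (f := fun i => Real.exp (gval N x T (k + 1) i - gval N x T k i)
        + Real.exp (gval N x T k i - gval N x T (k + 1) (i + 1)))
      (fun _ _ => by positivity) (Finset.mem_Icc.2 ⟨hi, hik⟩)
  have e₁ := Real.add_one_le_exp (gval N x T (k + 1) i - gval N x T k i)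
  have e₂ := Real.add_one_le_exp (gval N x T k i - gval N x T (k + 1) (i + 1))
  have p₁ := Real.exp_pos (gval N x T (k + 1) i - gval N x T k i)
  have p₂ := Real.exp_pos (gval N x T k i - gval N x T (k + 1) (i + 1))
  rw [abs_le] at *
  constructor <;> linarith

lemma abs_gval_top_le (N : ℕ) (x : Fin N → ℝ) (T : GIdx N → ℝ) {i : ℕ}
    (hi : 1 ≤ i) (hiN : i ≤ N) : |gval N x T N i| ≤ ∑ j, |x j| := by
  rw [gval, dif_neg (by omega), dif_pos ⟨rfl, hi, hiN⟩]
  exact Finset.single_le_sum (f := fun j => |x j|) (fun _ _ => abs_nonneg _) (Finset.mem_univ _)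

lemma abs_gval_le (N : ℕ) (x : Fin N → ℝ) (T : GIdx N → ℝ) {k i : ℕ} (hi : 1 ≤ i)
    (hik : i ≤ k) (hkN : k ≤ N) :
    |gval N x T k i| ≤ ∑ j, |x j| + ∑ l ∈ Finset.Icc 1 (N - 1), rowEnergy N x T l := by
  suffices h : |gval N x T k i| ≤ ∑ j, |x j| + ∑ l ∈ Finset.Ico k N, rowEnergy N x T l by
    refine h.trans (add_le_add_right (Finset.sum_le_sum_of_subset_of_nonneg (fun l hl => ?_)
      fun _ _ _ => rowEnergy_nonneg ..) _)
    rw [Finset.mem_Ico] at hl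
    rw [Finset.mem_Icc]
    omega
  induction hkN using Nat.decreasingInduction generalizing i with
  | self => simpa using abs_gval_top_le N x T hi hik
  | of_succ k hk ih =>
    rw [Finset.sum_eq_sum_Ico_succ_bot hk, add_comm (rowEnergy N x T k), ← add_assoc]
    exact abs_gval_le_add_rowEnergy N x T hi hik (ih hi (by omega)) (ih (by omega) (by omega))

lemma sum_abs_le (N : ℕ) (x : Fin N → ℝ) (T : GIdx N → ℝ) :
    ∑ p, |T p| ≤ Fintype.card (GIdx N) *
      (∑ j, |x j| + ∑ l ∈ Finset.Icc 1 (N - 1), rowEnergy N x T l) := by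
  rw [← nsmul_eq_mul, ← Finset.card_univ]
  refine Finset.sum_le_card_nsmul _ _ _ fun p _ => ?_
  have hp := p.2
  have h := abs_gval_le N x T (k := p.1.1 + 1) (i := p.1.2 + 1) (by omega) (by omega) (by omega)
  rwa [gval, dif_pos (by omega)] at h

lemma integrable_givIntegrand (N : ℕ) {hbar : ℝ} (hhbar : 0 < hbar) (lam x : Fin N → ℝ) :
    Integrable (givIntegrand N hbar lam x) := by
  let n : ℝ := (Fintype.card (GIdx N) : ℝ)
  have hn0 : 0 ≤ n := Nat.cast_nonneg _
  let X : ℝ := ∑ j, |x j|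
  have hX0 : 0 ≤ X := Finset.sum_nonneg fun _ _ => abs_nonneg _
  have hc : 0 < 1 / (hbar * (n + 1)) := by positivity
  refine Integrable.mono' ((integrable_exp_neg_mul_sum_abs (ι := GIdx N) hc).const_mul
    (Real.exp (X / hbar))) (continuous_givIntegrand N hbar lam x).aestronglyMeasurable
    (Filter.Eventually.of_forall fun T => ?_)
  rw [norm_givIntegrand, ← Real.exp_add, Real.exp_le_exp]
  let V := ∑ k ∈ Finset.Icc 1 (N - 1), rowEnergy N x T k
  have hV0 : 0 ≤ V := Finset.sum_nonneg fun _ _ => rowEnergy_nonneg ..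
  have h : ∑ p, |T p| ≤ n * (X + V) := sum_abs_le N x T
  have h' : 1 / (hbar * (n + 1)) * ∑ p, |T p| ≤ (X + V) / hbar := by
    rw [one_div_mul_eq_div, div_le_div_iff₀ (by positivity) hhbar]
    nlinarith [mul_nonneg hhbar.le (add_nonneg hX0 hV0), mul_le_mul_of_nonneg_left h hhbar.le]
  rw [add_div] at h'
  linarith

/-! ### Splitting off the top row -/

/-- The indices of size `M + 1` are those of the new top row together with those of size `M`. -/
def topRowEquiv (M : ℕ) : Fin M ⊕ GIdx M ≃ GIdx (M + 1) where
  toFun := Sum.elim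
    (fun i => ⟨(⟨M - 1, by omega⟩, i.castSucc), by
      have := i.isLt
      constructor <;> simp only [Fin.val_castSucc] <;> omega⟩)
    (fun p => ⟨(p.1.1.castSucc, p.1.2.castSucc), by
      have := p.2
      constructor <;> simp only [Fin.val_castSucc] <;> omega⟩)
  invFun p :=
    if h : p.1.1.val + 1 = M then .inl ⟨p.1.2, by have := p.2; omega⟩
    else .inr ⟨(⟨p.1.1, by have := p.2; omega⟩, ⟨p.1.2, by have := p.2; omega⟩), by
      have := p.2
      constructor <;> dsimp only <;> omega⟩
  left_inv := by
    rintro (i | ⟨⟨a, b⟩, hab⟩)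
    · have := i.isLt
      have h : M - 1 + 1 = M := by omega
      simp [h]
    · have h : ¬ a.val + 1 = M := by dsimp only at hab; omega
      simp [h]
  right_inv := by
    rintro ⟨⟨a, b⟩, hab⟩
    by_cases h : a.val + 1 = M
    · simp only [h, dite_true, Sum.elim_inl, Subtype.mk.injEq, Prod.mk.injEq]
      exact ⟨Fin.ext (by simp only; omega), Fin.ext rfl⟩
    · simp [h]

/-- Separate the top row of a point of the integration domain from the other rows. -/
def splitTopRow (M : ℕ) : (GIdx (M + 1) → ℝ) ≃ᵐ (Fin M → ℝ) × (GIdx M → ℝ) :=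
  (MeasurableEquiv.piCongrLeft (fun _ => ℝ) (topRowEquiv M)).symm.trans
    (MeasurableEquiv.sumPiEquivProdPi fun _ => ℝ)

lemma measurePreserving_splitTopRow (M : ℕ) :
    MeasurePreserving (splitTopRow M) volume volume :=
  (volume_measurePreserving_sumPiEquivProdPi fun _ : Fin M ⊕ GIdx M => ℝ).comp
    (volume_measurePreserving_piCongrLeft (fun _ => ℝ) (topRowEquiv M)).symm

lemma splitTopRow_apply (M : ℕ) (T : GIdx (M + 1) → ℝ) :
    splitTopRow M T =
      (fun i => T (topRowEquiv M (.inl i)), fun p => T (topRowEquiv M (.inr p))) :=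
  rfl

lemma gval_succ_top (M : ℕ) (x : Fin (M + 1) → ℝ) (T : GIdx (M + 1) → ℝ) (i : Fin (M + 1)) :
    gval (M + 1) x T (M + 1) (i + 1) = x i := by
  have := i.isLt
  rw [gval, dif_neg (by omega), dif_pos (by omega)]
  rfl

lemma gval_top (M : ℕ) (y : Fin M → ℝ) (S : GIdx M → ℝ) (i : Fin M) :
    gval M y S M (i + 1) = y i := by
  have := i.isLt
  rw [gval, dif_neg (by omega), dif_pos (by omega)]
  rfl

lemma gval_succ (M : ℕ) (x : Fin (M + 1) → ℝ) (T : GIdx (M + 1) → ℝ) {k i : ℕ}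
    (hi : 1 ≤ i) (hik : i ≤ k) (hkM : k ≤ M) :
    gval (M + 1) x T k i = gval M (splitTopRow M T).1 (splitTopRow M T).2 k i := by
  rw [splitTopRow_apply, gval, dif_pos (by omega), gval]
  by_cases h : k ≤ M - 1
  · rw [dif_pos ⟨hi, hik, h⟩]
    rfl
  · have hk : k = M := by omega
    subst hk
    rw [dif_neg (by omega), dif_pos (by omega)]
    rfl

lemma sum_Icc_one_eq_sum_fin {E : Type*} [AddCommMonoid E] (n : ℕ) (f : ℕ → E) :
    ∑ i ∈ Finset.Icc 1 n, f i = ∑ i : Fin n, f (i + 1) := by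
  rw [Fin.sum_univ_eq_sum_range (fun i => f (i + 1)) n, Finset.range_eq_Ico,
    Finset.sum_Ico_add' f 0 n 1]
  congr 1

lemma Fpot_succ (M : ℕ) (hM : 1 ≤ M) (lam x : Fin (M + 1) → ℝ) (T : GIdx (M + 1) → ℝ) :
    Fpot (M + 1) lam x T =
      (Complex.I * lam (Fin.last M) *
          ((∑ i, (x i : ℂ)) - ∑ i, ((splitTopRow M T).1 i : ℂ))
        - ∑ i : Fin M, ((Real.exp (x i.castSucc - (splitTopRow M T).1 i) : ℂ)
            + (Real.exp ((splitTopRow M T).1 i - x i.succ) : ℂ)))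
      + Fpot M (fun i => lam i.castSucc) (splitTopRow M T).1 (splitTopRow M T).2 := by
  have hrow : ∀ k ≤ M, ∑ i ∈ Finset.Icc 1 k, (gval (M + 1) x T k i : ℂ)
      = ∑ i ∈ Finset.Icc 1 k, (gval M (splitTopRow M T).1 (splitTopRow M T).2 k i : ℂ) := by
    intro k hk
    refine Finset.sum_congr rfl fun i hi => ?_
    rw [Finset.mem_Icc] at hi
    rw [gval_succ M x T hi.1 hi.2 hk]
  have hF : ∀ k ∈ Finset.Icc 1 (M - 1), ∑ i ∈ Finset.Icc 1 k,
        ((Real.exp (gval (M + 1) x T (k + 1) i - gval (M + 1) x T k i) : ℂ)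
          + (Real.exp (gval (M + 1) x T k i - gval (M + 1) x T (k + 1) (i + 1)) : ℂ))
      = ∑ i ∈ Finset.Icc 1 k,
        ((Real.exp (gval M (splitTopRow M T).1 (splitTopRow M T).2 (k + 1) i
            - gval M (splitTopRow M T).1 (splitTopRow M T).2 k i) : ℂ)
          + (Real.exp (gval M (splitTopRow M T).1 (splitTopRow M T).2 k i
            - gval M (splitTopRow M T).1 (splitTopRow M T).2 (k + 1) (i + 1)) : ℂ)) := by
    intro k hk
    rw [Finset.mem_Icc] at hk
    refine Finset.sum_congr rfl fun i hi => ?_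
    rw [Finset.mem_Icc] at hi
    rw [gval_succ M x T hi.1 hi.2 (by omega),
      gval_succ M x T (k := k + 1) hi.1 (by omega) (by omega),
      gval_succ M x T (k := k + 1) (i := i + 1) (by omega) (by omega) (by omega)]
  have hlast : ∀ f : ℕ → ℂ,
      ∑ k ∈ Finset.Icc 1 M, f k = ∑ k ∈ Finset.Icc 1 (M - 1), f k + f M := by
    intro f
    obtain ⟨m, rfl⟩ := Nat.exists_eq_add_of_le' hM
    exact Finset.sum_Icc_succ_top (by omega) f
  have htop : ∑ i ∈ Finset.Icc 1 M,
        ((Real.exp (gval (M + 1) x T (M + 1) i - gval (M + 1) x T M i) : ℂ)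
          + (Real.exp (gval (M + 1) x T M i - gval (M + 1) x T (M + 1) (i + 1)) : ℂ))
      = ∑ i : Fin M, ((Real.exp (x i.castSucc - (splitTopRow M T).1 i) : ℂ)
            + (Real.exp ((splitTopRow M T).1 i - x i.succ) : ℂ)) := by
    rw [sum_Icc_one_eq_sum_fin]
    refine Finset.sum_congr rfl fun i _ => ?_
    have h₁ := gval_succ_top M x T i.castSucc
    have h₂ := gval_succ_top M x T i.succ
    rw [Fin.val_castSucc] at h₁
    rw [Fin.val_succ] at h₂
    rw [h₁, h₂, gval_succ M x T (by omega) (by omega) le_rfl, gval_top]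
  have hphase : ∀ a : Fin M,
      ((∑ i ∈ Finset.Icc 1 (a.castSucc.val + 1), (gval (M + 1) x T (a.castSucc.val + 1) i : ℂ))
        - ∑ i ∈ Finset.Icc 1 a.castSucc.val, (gval (M + 1) x T a.castSucc.val i : ℂ))
      = ((∑ i ∈ Finset.Icc 1 (a.val + 1),
          (gval M (splitTopRow M T).1 (splitTopRow M T).2 (a.val + 1) i : ℂ))
        - ∑ i ∈ Finset.Icc 1 a.val,
          (gval M (splitTopRow M T).1 (splitTopRow M T).2 a.val i : ℂ)) := by
    intro a
    rw [Fin.val_castSucc, hrow _ (by omega), hrow _ (by omega)]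
  unfold Fpot
  rw [Fin.sum_univ_castSucc, Nat.add_sub_cancel, hlast, Finset.sum_congr rfl hF, htop,
    Finset.sum_congr rfl fun a _ => by rw [hphase a], Fin.val_last, hrow M le_rfl,
    sum_Icc_one_eq_sum_fin (M + 1), sum_Icc_one_eq_sum_fin M]
  simp only [gval_succ_top, gval_top]
  ring

lemma givIntegrand_succ (M : ℕ) (hM : 1 ≤ M) (hbar : ℝ) (lam x : Fin (M + 1) → ℝ)
    (T : GIdx (M + 1) → ℝ) :
    givIntegrand (M + 1) hbar lam x T =
      Qker (M + 1) hbar (lam (Fin.last M) : ℂ) x (splitTopRow M T).1 *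
        givIntegrand M hbar (fun i => lam i.castSucc) (splitTopRow M T).1
          (splitTopRow M T).2 := by
  have hQ : Qker (M + 1) hbar (lam (Fin.last M) : ℂ) x (splitTopRow M T).1 =
      Complex.exp (Complex.I * lam (Fin.last M) / hbar *
          ((∑ i, (x i : ℂ)) - ∑ i, ((splitTopRow M T).1 i : ℂ))
        - 1 / hbar * ∑ i : Fin M, ((Real.exp (x i.castSucc - (splitTopRow M T).1 i) : ℂ)
            + (Real.exp ((splitTopRow M T).1 i - x i.succ) : ℂ))) := by
    have hx : ∀ i : Fin M, (if h : i.val + 1 < M + 1 then x ⟨i.val + 1, h⟩ else 0) = x i.succ :=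
      fun i => dif_pos _
    simp only [← hx]
    rfl
  rw [hQ, givIntegrand, givIntegrand, ← Complex.exp_add, Fpot_succ M hM]
  congr 1
  ring

theorem givental_recursion_succ (M : ℕ) (hM : 1 ≤ M) {hbar : ℝ} (hhbar : 0 < hbar)
    (lam x : Fin (M + 1) → ℝ) :
    Integrable (fun y : Fin M → ℝ =>
        Qker (M + 1) hbar (lam (Fin.last M) : ℂ) x y *
          GivPsi M hbar (fun i => lam i.castSucc) y) ∧
    GivPsi (M + 1) hbar lam x
      = ∫ y : Fin M → ℝ, Qker (M + 1) hbar (lam (Fin.last M) : ℂ) x y *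
          GivPsi M hbar (fun i => lam i.castSucc) y := by
  let G : (Fin M → ℝ) × (GIdx M → ℝ) → ℂ := fun p =>
    Qker (M + 1) hbar (lam (Fin.last M) : ℂ) x p.1 *
      givIntegrand M hbar (fun i => lam i.castSucc) p.1 p.2
  have hcomp : givIntegrand (M + 1) hbar lam x = G ∘ splitTopRow M :=
    funext fun T => givIntegrand_succ M hM hbar lam x T
  have hF : Integrable G (volume.prod volume) := by
    have h := integrable_givIntegrand (M + 1) hhbar lam x
    rwa [hcomp, (measurePreserving_splitTopRow M).integrable_comp_emb
      (splitTopRow M).measurableEmbedding] at h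
  have hinner : ∀ y, ∫ S, G (y, S) = Qker (M + 1) hbar (lam (Fin.last M) : ℂ) x y *
      GivPsi M hbar (fun i => lam i.castSucc) y := fun y =>
    integral_const_mul (Qker (M + 1) hbar (lam (Fin.last M) : ℂ) x y)
      (givIntegrand M hbar (fun i => lam i.castSucc) y)
  constructor
  · simpa only [hinner] using hF.integral_prod_left
  · rw [GivPsi, hcomp]
    refine ((measurePreserving_splitTopRow M).integral_comp
      (splitTopRow M).measurableEmbedding G).trans ?_
    refine (integral_prod G hF).trans ?_
    simp only [hinner]

/-- the recursion for the Givental integral,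
`Ψ^{(N)}_{λ_1,…,λ_N}(x) = ∫_{ℝ^{N−1}} Q^{(N)}_{λ_N}(x; y) Ψ^{(N−1)}_{λ_1,…,λ_{N−1}}(y) dy`,
with the right-hand integrand absolutely integrable. -/
theorem givental_recursion (N : ℕ) (hN : 3 ≤ N)
    (hbar : ℝ) (hhbar : 0 < hbar) (lam : Fin N → ℝ) (x : Fin N → ℝ) :
    Integrable (fun y : Fin (N - 1) → ℝ =>
        Qker N hbar ((lam ⟨N - 1, by omega⟩ : ℝ) : ℂ) x y *
          GivPsi (N - 1) hbar (fun i => lam (Fin.castLE (Nat.sub_le N 1) i)) y) ∧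
    GivPsi N hbar lam x
      = ∫ y : Fin (N - 1) → ℝ,
          Qker N hbar ((lam ⟨N - 1, by omega⟩ : ℝ) : ℂ) x y *
            GivPsi (N - 1) hbar (fun i => lam (Fin.castLE (Nat.sub_le N 1) i)) y := by
  obtain ⟨M, rfl⟩ := Nat.exists_eq_add_of_le' (show 1 ≤ N by omega)
  exact givental_recursion_succ M (by omega) hhbar lam x
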